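/- Let n ≥ 2, 0 < s < 1 with n > 2s, and let u ≢ 0 be a nonnegative viscosity super-solution of (−Δ)^s u = 0 in ℝⁿ. Then there exist constants C > 0 and R₀ > 0, independent of u, such that min_{|x|≤r/2} u(x) ≤ C · min_{|x|≤r} u(x) for all r ≥ R₀. -/

import Mathlib

open MeasureTheory

/-- The fractional Laplacian `(-Δ)^s` (normalization constant `C(n,s) = 1`),
written via second differences. -/
noncomputable def fracLap (n : ℕ) (s : ℝ) (u : EuclideanSpace ℝ (Fin n) → ℝ)
    (x : EuclideanSpace ℝ (Fin n)) : ℝ :=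
  -(1/2 : ℝ) * ∫ y : EuclideanSpace ℝ (Fin n),
    (u (x + y) + u (x - y) - 2 * u x) / ‖y‖ ^ ((n : ℝ) + 2 * s)

/-- `u` is a viscosity super-solution of `(-Δ)^s u = f` in all of ℝⁿ. -/
def ViscSupersol (n : ℕ) (s : ℝ) (f u : EuclideanSpace ℝ (Fin n) → ℝ) : Prop :=
  Continuous u ∧
  ∀ (x₀ : EuclideanSpace ℝ (Fin n)) (φ : EuclideanSpace ℝ (Fin n) → ℝ),
    ContDiff ℝ 2 φ → φ x₀ = u x₀ → (∀ x, φ x ≤ u x) → f x₀ ≤ fracLap n s φ x₀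

/-- The Lévy-type kernel `min(|y|², 1) / |y|^(n+2s)` is integrable on `ℝⁿ` for `0 < s < 1`. -/
lemma integrable_min_sq_one_div_norm_rpow {n : ℕ} {s : ℝ} (hn : 1 ≤ n) (hs : 0 < s)
    (hs1 : s < 1) :
    Integrable (fun y : EuclideanSpace ℝ (Fin n) =>
      min (‖y‖ ^ 2) 1 / ‖y‖ ^ ((n : ℝ) + 2 * s)) := by
  have : Nonempty (Fin n) := ⟨⟨0, hn⟩⟩
  have hpow : ∀ y : ℝ, 0 < y → y ^ (n - 1) = y ^ ((n : ℝ) - 1) := fun y hy => by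
    rw [← Real.rpow_natCast, Nat.cast_sub hn, Nat.cast_one]
  rw [integrable_fun_norm_addHaar volume
    (f := fun t : ℝ => min (t ^ 2) 1 / t ^ ((n : ℝ) + 2 * s)), finrank_euclideanSpace_fin,
    ← Set.Ioc_union_Ioi_eq_Ioi zero_le_one]
  refine IntegrableOn.union ?_ ?_
  · have h := (intervalIntegral.intervalIntegrable_rpow' (a := 0) (b := 1)
      (r := 1 - 2 * s) (by linarith)).1
    refine h.congr_fun (fun y hy => ?_) measurableSet_Ioc
    have hy0 : 0 < y := hy.1
    simp only [smul_eq_mul]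
    rw [min_eq_left (pow_le_one₀ hy0.le hy.2), hpow y hy0, ← Real.rpow_natCast y 2,
      ← Real.rpow_sub hy0, ← Real.rpow_add hy0]
    congr 1
    push_cast
    ring
  · have h := integrableOn_Ioi_rpow_of_lt (a := -1 - 2 * s) (by linarith) one_pos
    refine h.congr_fun (fun y hy => ?_) measurableSet_Ioi
    have hy1 : 1 < y := hy
    have hy0 : 0 < y := by linarith
    simp only [smul_eq_mul]
    rw [min_eq_right (one_le_pow₀ hy1.le), hpow y hy0, one_div, ← Real.rpow_neg hy0.le,
      ← Real.rpow_add hy0]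
    congr 1
    ring

/-- Second differences of a compactly supported `C²` function are `O(min(|y|², 1))`, uniformly
in the base point. -/
lemma exists_abs_second_difference_le {E : Type*} [NormedAddCommGroup E] [NormedSpace ℝ E]
    {ψ : E → ℝ} (hψ : ContDiff ℝ 2 ψ) (hc : HasCompactSupport ψ) :
    ∃ K : ℝ, 0 ≤ K ∧ ∀ x y : E, |ψ (x + y) + ψ (x - y) - 2 * ψ x| ≤ K * min (‖y‖ ^ 2) 1 := by
  obtain ⟨B, hB⟩ := hc.exists_bound_of_continuous hψ.continuous
  obtain ⟨L, hL⟩ := ContDiff.lipschitzWith_of_hasCompactSupport (𝕂 := ℝ) (n := 1) (hc.fderiv ℝ)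
    (hψ.fderiv_right (by norm_num)) one_ne_zero
  have hB0 : 0 ≤ B := (norm_nonneg _).trans (hB 0)
  have taylor : ∀ x y : E, |ψ (x + y) - ψ x - fderiv ℝ ψ x y| ≤ L * ‖y‖ ^ 2 := by
    intro x y
    have h := (convex_closedBall x ‖y‖).norm_image_sub_le_of_norm_fderiv_le' (𝕜 := ℝ) (f := ψ)
      (φ := fderiv ℝ ψ x) (C := L * ‖y‖) (x := x) (y := x + y)
      (fun z _ => (hψ.differentiable (by norm_num)) z)
      (fun z hz => by
        have h1 := hL.dist_le_mul z x
        rw [dist_eq_norm] at h1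
        exact h1.trans (mul_le_mul_of_nonneg_left hz L.2))
      (by simp) (by simp)
    simpa [pow_two, mul_assoc] using h
  refine ⟨2 * L + 4 * B, by positivity, fun x y => ?_⟩
  have hL0 : (0 : ℝ) ≤ L := L.2
  rcases le_total (‖y‖ ^ 2) 1 with h | h
  · rw [min_eq_left h]
    have h1 := taylor x y
    have h2 := taylor x (-y)
    rw [norm_neg, map_neg, ← sub_eq_add_neg] at h2
    rw [abs_le] at *
    have : 0 ≤ B * ‖y‖ ^ 2 := by positivity
    constructor <;> linarith [h1.1, h1.2, h2.1, h2.2]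
  · rw [min_eq_right h]
    have h1 := hB (x + y)
    have h2 := hB (x - y)
    have h3 := hB x
    rw [Real.norm_eq_abs, abs_le] at h1 h2 h3
    rw [abs_le]
    constructor <;> linarith [h1.1, h1.2, h2.1, h2.2, h3.1, h3.2]

/-- For a compactly supported `C²` function the integrand of the fractional Laplacian is
integrable and its integral is bounded uniformly in the base point. -/
lemma exists_integrable_second_difference {n : ℕ} {s : ℝ} (hn : 1 ≤ n) (hs : 0 < s) (hs1 : s < 1)
    {ψ : EuclideanSpace ℝ (Fin n) → ℝ} (hψ : ContDiff ℝ 2 ψ) (hc : HasCompactSupport ψ) :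
    ∃ K : ℝ, 0 ≤ K ∧ ∀ x : EuclideanSpace ℝ (Fin n),
      Integrable (fun y : EuclideanSpace ℝ (Fin n) =>
        (ψ (x + y) + ψ (x - y) - 2 * ψ x) / ‖y‖ ^ ((n : ℝ) + 2 * s)) ∧
      |∫ y : EuclideanSpace ℝ (Fin n),
        (ψ (x + y) + ψ (x - y) - 2 * ψ x) / ‖y‖ ^ ((n : ℝ) + 2 * s)| ≤ K := by
  obtain ⟨K, hK0, hK⟩ := exists_abs_second_difference_le hψ hc
  have hint := (integrable_min_sq_one_div_norm_rpow hn hs hs1).const_mul K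
  refine ⟨∫ y : EuclideanSpace ℝ (Fin n), K * (min (‖y‖ ^ 2) 1 / ‖y‖ ^ ((n : ℝ) + 2 * s)),
    integral_nonneg fun y => by positivity, fun x => ?_⟩
  have hle : ∀ y : EuclideanSpace ℝ (Fin n),
      ‖(ψ (x + y) + ψ (x - y) - 2 * ψ x) / ‖y‖ ^ ((n : ℝ) + 2 * s)‖ ≤
        K * (min (‖y‖ ^ 2) 1 / ‖y‖ ^ ((n : ℝ) + 2 * s)) := by
    intro y
    have h0 : 0 ≤ ‖y‖ ^ ((n : ℝ) + 2 * s) := by positivity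
    rw [norm_div, Real.norm_eq_abs, Real.norm_of_nonneg h0, ← mul_div_assoc]
    exact div_le_div_of_nonneg_right (hK x y) h0
  have hmeas : Measurable (fun y : EuclideanSpace ℝ (Fin n) =>
      (ψ (x + y) + ψ (x - y) - 2 * ψ x) / ‖y‖ ^ ((n : ℝ) + 2 * s)) := by
    have h1 : Measurable ψ := hψ.continuous.measurable
    fun_prop
  exact ⟨hint.mono' hmeas.aestronglyMeasurable (.of_forall hle),
    norm_integral_le_of_norm_le hint (.of_forall hle)⟩

/-- Affine changes of the values act on `fracLap` through the slope only. -/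
lemma fracLap_const_mul_add (n : ℕ) (s a c : ℝ) (ψ : EuclideanSpace ℝ (Fin n) → ℝ)
    (x : EuclideanSpace ℝ (Fin n)) :
    fracLap n s (fun z => a * ψ z + c) x = a * fracLap n s ψ x := by
  unfold fracLap
  rw [mul_left_comm]
  congr 1
  rw [← integral_const_mul]
  refine integral_congr_ae (.of_forall fun y => ?_)
  dsimp only
  ring

/-- `fracLap` is homogeneous of degree `2s` under dilations. -/
lemma fracLap_comp_inv_smul (n : ℕ) (s : ℝ) {r : ℝ} (hr : 0 < r)
    (ψ : EuclideanSpace ℝ (Fin n) → ℝ) (x : EuclideanSpace ℝ (Fin n)) :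
    fracLap n s (fun z => ψ (r⁻¹ • z)) x
      = r ^ n / r ^ ((n : ℝ) + 2 * s) * fracLap n s ψ (r⁻¹ • x) := by
  unfold fracLap
  have h := Measure.integral_comp_inv_smul_of_nonneg volume
    (fun y : EuclideanSpace ℝ (Fin n) =>
      (ψ (r⁻¹ • x + y) + ψ (r⁻¹ • x - y) - 2 * ψ (r⁻¹ • x)) / ‖y‖ ^ ((n : ℝ) + 2 * s)) hr.le
  rw [finrank_euclideanSpace_fin, smul_eq_mul] at h
  rw [mul_left_comm, div_mul_eq_mul_div, ← h]
  congr 1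
  rw [div_eq_inv_mul, ← integral_const_mul]
  refine integral_congr_ae (.of_forall fun y => ?_)
  dsimp only
  have hr' : 0 < r ^ ((n : ℝ) + 2 * s) := by positivity
  rw [norm_smul, Real.norm_of_nonneg (by positivity), Real.mul_rpow (by positivity) (by positivity),
    Real.inv_rpow hr.le, smul_add, smul_sub]
  field_simp

/-- A smooth barrier: at most one, vanishing outside the ball of radius `2`, bounded below by
`ε` on the unit ball, and strictly `s`-subharmonic in the annulus `1/2 < |x| ≤ 2`. -/
lemma exists_barrier {n : ℕ} {s : ℝ} (hn : 1 ≤ n) (hs : 0 < s) (hs1 : s < 1) :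
    ∃ ε > (0 : ℝ), ∃ ψ : EuclideanSpace ℝ (Fin n) → ℝ, ContDiff ℝ 2 ψ ∧ (∀ x, ψ x ≤ 1) ∧
      (∀ x, 2 ≤ ‖x‖ → ψ x = 0) ∧ (∀ x, ‖x‖ ≤ 1 → ε ≤ ψ x) ∧
      ∀ x, 1 / 2 < ‖x‖ → ‖x‖ ≤ 2 → fracLap n s ψ x < 0 := by
  let η : ContDiffBump (0 : EuclideanSpace ℝ (Fin n)) := ⟨1 / 8, 1 / 4, by norm_num, by norm_num⟩
  let ζ : ContDiffBump (0 : EuclideanSpace ℝ (Fin n)) := ⟨1, 2, by norm_num, by norm_num⟩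
  obtain ⟨_, -, hη⟩ := exists_integrable_second_difference hn hs hs1 η.contDiff η.hasCompactSupport
  obtain ⟨K, hK0, hζ⟩ :=
    exists_integrable_second_difference hn hs hs1 ζ.contDiff ζ.hasCompactSupport
  set p : ℝ := (n : ℝ) + 2 * s with hp
  have hp0 : 0 < p := by positivity
  have hη0 : ∀ x : EuclideanSpace ℝ (Fin n), 1 / 4 ≤ ‖x‖ → η x = 0 := fun x hx =>
    η.zero_of_le_dist (by simpa [η] using hx)
  have hζ0 : ∀ x : EuclideanSpace ℝ (Fin n), 2 ≤ ‖x‖ → ζ x = 0 := fun x hx =>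
    ζ.zero_of_le_dist (by simpa [ζ] using hx)
  set V : ℝ := volume.real (Metric.closedBall (0 : EuclideanSpace ℝ (Fin n)) (1 / 8)) with hV
  have hV0 : 0 < V := by
    refine ENNReal.toReal_pos ?_ measure_closedBall_lt_top.ne
    exact (Metric.measure_closedBall_pos volume _ (by norm_num)).ne'
  set c : ℝ := V * (1 / 3 ^ p) with hc
  have hc0 : 0 < c := by positivity
  have hlow : ∀ x : EuclideanSpace ℝ (Fin n), 1 / 2 < ‖x‖ → ‖x‖ ≤ 2 →
      c ≤ ∫ y : EuclideanSpace ℝ (Fin n), (η (x + y) + η (x - y) - 2 * η x) / ‖y‖ ^ p := by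
    intro x hx1 hx2
    have hVx : volume.real (Metric.closedBall (-x) (1 / 8)) = V := by
      rw [hV, Measure.real, Measure.real, Measure.addHaar_closedBall_center]
    have hind : ∫ y, (Metric.closedBall (-x) (1 / 8)).indicator
        (fun _ : EuclideanSpace ℝ (Fin n) => (1 / 3 ^ p : ℝ)) y = c := by
      rw [integral_indicator_const _ Metric.isClosed_closedBall.measurableSet, hVx, smul_eq_mul]
    rw [← hind]
    refine integral_mono ?_ (hη x).1 fun y => ?_
    · exact (integrable_indicator_iff Metric.isClosed_closedBall.measurableSet).2
        (integrableOn_const measure_closedBall_lt_top.ne)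
    have hx0 : η x = 0 := hη0 x (by linarith)
    have hnn : 0 ≤ η (x - y) := η.nonneg
    have hnn' : 0 ≤ η (x + y) := η.nonneg
    simp only [hx0, mul_zero, sub_zero]
    by_cases hy : y ∈ Metric.closedBall (-x) (1 / 8)
    · rw [Set.indicator_of_mem hy]
      rw [mem_closedBall_iff_norm, sub_neg_eq_add, add_comm] at hy
      have h1 : η (x + y) = 1 := η.one_of_mem_closedBall (by simpa [η] using hy)
      have hy3 : ‖y‖ ≤ 3 := by
        have := norm_sub_le (x + y) x
        rw [add_sub_cancel_left] at this
        linarith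
      have hy0 : 0 < ‖y‖ := by
        have := norm_sub_le (x + y) y
        rw [add_sub_cancel_right] at this
        linarith
      have hle : ‖y‖ ^ p ≤ 3 ^ p := Real.rpow_le_rpow hy0.le hy3 hp0.le
      exact div_le_div₀ (by linarith) (by linarith) (by positivity) hle
    · rw [Set.indicator_of_notMem hy]
      positivity
  set ε : ℝ := min (1 / 2) (c / (4 * (K + 1))) with hε
  have hε0 : 0 < ε := by positivity
  have hε1 : ε ≤ 1 / 2 := min_le_left _ _
  have hε2 : ε * K < c / 2 := by
    have h : ε * (4 * (K + 1)) ≤ c := (le_div_iff₀ (by positivity)).1 (min_le_right _ _)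
    nlinarith
  refine ⟨ε, hε0, fun x => 1 / 2 * η x + ε * ζ x,
    (contDiff_const.mul η.contDiff).add (contDiff_const.mul ζ.contDiff), fun x => ?_,
    fun x hx => ?_, fun x hx => ?_, fun x hx1 hx2 => ?_⟩
  · have h1 : η x ≤ 1 := η.le_one
    have h2 : ζ x ≤ 1 := ζ.le_one
    nlinarith
  · simp [hη0 x (by linarith), hζ0 x hx]
  · have h1 : 0 ≤ η x := η.nonneg
    have h2 : ζ x = 1 := ζ.one_of_mem_closedBall (by simpa [ζ] using hx)
    simp only [h2]
    linarith
  · have hsplit : ∫ y : EuclideanSpace ℝ (Fin n),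
        ((1 / 2 * η (x + y) + ε * ζ (x + y)) + (1 / 2 * η (x - y) + ε * ζ (x - y))
          - 2 * (1 / 2 * η x + ε * ζ x)) / ‖y‖ ^ p =
        1 / 2 * (∫ y : EuclideanSpace ℝ (Fin n),
          (η (x + y) + η (x - y) - 2 * η x) / ‖y‖ ^ p) +
        ε * ∫ y : EuclideanSpace ℝ (Fin n), (ζ (x + y) + ζ (x - y) - 2 * ζ x) / ‖y‖ ^ p := by
      rw [← integral_const_mul, ← integral_const_mul,
        ← integral_add ((hη x).1.const_mul _) ((hζ x).1.const_mul _)]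
      congr 1
      ext y
      ring
    unfold fracLap
    rw [← hp, hsplit]
    have h1 := hlow x hx1 hx2
    have h2 := mul_le_mul_of_nonneg_left (abs_le.1 (hζ x).2).1 hε0.le
    linarith

/-- Comparison of a nonnegative super-solution with a dilated barrier. -/
lemma ViscSupersol.barrier_le {n : ℕ} {s : ℝ} {u ψ : EuclideanSpace ℝ (Fin n) → ℝ}
    (hu0 : ∀ x, 0 ≤ u x) (hu : ViscSupersol n s (fun _ => 0) u) (hψ : ContDiff ℝ 2 ψ)
    (hψ1 : ∀ x, ψ x ≤ 1) (hψ0 : ∀ x, 2 ≤ ‖x‖ → ψ x = 0)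
    (hsub : ∀ x, 1 / 2 < ‖x‖ → ‖x‖ ≤ 2 → fracLap n s ψ x < 0)
    {r m : ℝ} (hr : 0 < r) (hm : 0 < m) (hmu : ∀ x, ‖x‖ ≤ r / 2 → m ≤ u x)
    (z : EuclideanSpace ℝ (Fin n)) : m * ψ (r⁻¹ • z) ≤ u z := by
  by_contra! hz
  have hnorm : ∀ x : EuclideanSpace ℝ (Fin n), ‖r⁻¹ • x‖ = ‖x‖ / r := fun x => by
    rw [norm_smul, Real.norm_of_nonneg (by positivity), div_eq_inv_mul]
  have hout : ∀ x : EuclideanSpace ℝ (Fin n), 2 * r ≤ ‖x‖ → ψ (r⁻¹ • x) = 0 := fun x hx =>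
    hψ0 _ (by rwa [hnorm, le_div_iff₀ hr])
  have hzmem : z ∈ Metric.closedBall (0 : EuclideanSpace ℝ (Fin n)) (2 * r) := by
    rw [mem_closedBall_zero_iff]
    by_contra! h
    rw [hout z h.le, mul_zero] at hz
    exact (hu0 z).not_gt hz
  have hcont : Continuous fun x => u x - m * ψ (r⁻¹ • x) :=
    hu.1.sub (continuous_const.mul (hψ.continuous.comp (continuous_const_smul _)))
  obtain ⟨x₀, hx₀, hmin⟩ := (isCompact_closedBall (0 : EuclideanSpace ℝ (Fin n))
    (2 * r)).exists_isMinOn ⟨z, hzmem⟩ hcont.continuousOn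
  have hneg : u x₀ - m * ψ (r⁻¹ • x₀) < 0 := lt_of_le_of_lt (hmin hzmem) (by simpa using hz)
  have hglob : ∀ x, u x₀ - m * ψ (r⁻¹ • x₀) ≤ u x - m * ψ (r⁻¹ • x) := by
    intro x
    by_cases hx : x ∈ Metric.closedBall (0 : EuclideanSpace ℝ (Fin n)) (2 * r)
    · exact hmin hx
    · rw [mem_closedBall_zero_iff, not_le] at hx
      rw [hout x hx.le]
      linarith [hu0 x]
  have hfar : r / 2 < ‖x₀‖ := by
    by_contra! h
    have h1 := hmu x₀ h
    nlinarith [hψ1 (r⁻¹ • x₀)]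
  have htest := hu.2 x₀ (fun x => m * ψ (r⁻¹ • x) + (u x₀ - m * ψ (r⁻¹ • x₀)))
    ((contDiff_const.mul (hψ.comp (contDiff_const_smul _))).add contDiff_const)
    (by ring) (fun x => by linarith [hglob x])
  rw [fracLap_const_mul_add n s m _ (fun x => ψ (r⁻¹ • x)), fracLap_comp_inv_smul n s hr] at htest
  have hlt := hsub (r⁻¹ • x₀) (by rw [hnorm, lt_div_iff₀ hr]; linarith)
    (by rw [hnorm, div_le_iff₀ hr]; exact mem_closedBall_zero_iff.1 hx₀)
  have hpos : 0 < r ^ n / r ^ ((n : ℝ) + 2 * s) := by positivity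
  exact htest.not_gt (mul_neg_of_pos_of_neg hm (mul_neg_of_pos_of_neg hpos hlt))

/-- Harnack-type doubling bound `m_u(r/2) ≤ C m_u(r)` for
nonnegative nontrivial viscosity super-solutions of `(-Δ)^s u = 0` (Lemma 2.2). -/
theorem stmt_11 (n : ℕ) (s : ℝ) (hn : 2 ≤ n) (hs : 0 < s) (hs1 : s < 1)
    (hns : 2 * s < (n : ℝ)) :
    ∃ C > 0, ∃ R₀ > (0 : ℝ), ∀ u : EuclideanSpace ℝ (Fin n) → ℝ,
      (∀ x, 0 ≤ u x) → u ≠ 0 → ViscSupersol n s (fun _ => 0) u →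
      ∀ r : ℝ, R₀ ≤ r →
        sInf (u '' Metric.closedBall 0 (r / 2)) ≤ C * sInf (u '' Metric.closedBall 0 r) := by
  obtain ⟨ε, hε, ψ, hψ, hψ1, hψ0, hψε, hsub⟩ := exists_barrier (n := n) (by omega) hs hs1
  refine ⟨ε⁻¹, inv_pos.2 hε, 1, one_pos, fun u hu0 _ hu r hr => ?_⟩
  have hr0 : 0 < r := by linarith
  have hnn : ∀ S : Set (EuclideanSpace ℝ (Fin n)), 0 ≤ sInf (u '' S) := fun S =>
    Real.sInf_nonneg (by rintro _ ⟨x, -, rfl⟩; exact hu0 x)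
  rcases (hnn (Metric.closedBall 0 (r / 2))).eq_or_lt with h | hm
  · rw [← h]
    exact mul_nonneg (inv_nonneg.2 hε.le) (hnn _)
  have hmu : ∀ x, ‖x‖ ≤ r / 2 → sInf (u '' Metric.closedBall 0 (r / 2)) ≤ u x := fun x hx =>
    csInf_le ⟨0, by rintro _ ⟨x, -, rfl⟩; exact hu0 x⟩
      ⟨x, mem_closedBall_zero_iff.2 hx, rfl⟩
  rw [← div_eq_inv_mul, le_div_iff₀ hε]
  refine le_csInf ((Metric.nonempty_closedBall.2 hr0.le).image u) ?_
  rintro _ ⟨x, hx, rfl⟩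
  refine le_trans ?_ (ViscSupersol.barrier_le hu0 hu hψ hψ1 hψ0 hsub hr0 hm hmu x)
  refine mul_le_mul_of_nonneg_left (hψε _ ?_) hm.le
  rw [norm_smul, norm_inv, Real.norm_of_nonneg hr0.le, inv_mul_le_iff₀ hr0, mul_one]
  exact mem_closedBall_zero_iff.1 hx
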